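/- Let X be a compact Hausdorff space, A a semisimple commutative unital Banach algebra, and 𝑨 an admissible A-valued uniform algebra on X with 𝔄 = 𝑨 ∩ C(X), such that every character of 𝑨 is of the form ψ⋄φ with ψ ∈ Φ(𝔄), φ ∈ Φ(A). If 𝔄 and A are strong Ditkin algebras, then 𝑨 is a strong Ditkin algebra. -/

import Mathlib

open WeakDual Topology

namespace VV

variable (B : Type*) [NormedCommRing B] [NormedAlgebra ℂ B]

/-- The ideal `I_ψ = {b | ψ b = 0}`. -/
def Iid (ψ : characterSpace ℂ B) : Set B := {b : B | ψ b = 0}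

/-- The ideal `J_ψ` of elements whose Gelfand transform vanishes on a
neighbourhood of `ψ`. -/
def Jid (ψ : characterSpace ℂ B) : Set B :=
  {b : B | ∃ U ∈ nhds ψ, ∀ χ ∈ U, χ b = 0}

/-- Regularity of a commutative Banach algebra. -/
def IsRegular : Prop :=
  ∀ E : Set (characterSpace ℂ B), IsClosed E →
    ∀ ψ₀ ∉ E, ∃ b : B, ψ₀ b ≠ 0 ∧ ∀ ψ ∈ E, ψ b = 0

def IsStronglyRegularAt (ψ : characterSpace ℂ B) : Prop :=
  Iid B ψ ⊆ closure (Jid B ψ)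

def IsStronglyRegular : Prop := ∀ ψ : characterSpace ℂ B, IsStronglyRegularAt B ψ

/-- Bounded relative units at a character. -/
def HasBRUAt (ψ : characterSpace ℂ B) : Prop :=
  ∃ M : ℝ, 0 < M ∧ ∀ K : Set (characterSpace ℂ B), IsCompact K → ψ ∉ K →
    ∃ b ∈ Jid B ψ, (∀ χ ∈ K, χ b = 1) ∧ ‖b‖ ≤ M

def HasBRU : Prop := ∀ ψ : characterSpace ℂ B, HasBRUAt B ψ

/-- Ditkin's condition at a character: `b ∈ closure (b • J_ψ)` for every `b ∈ I_ψ`. -/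
def DitkinAt (ψ : characterSpace ℂ B) : Prop :=
  ∀ b ∈ Iid B ψ, b ∈ closure ((fun u => b * u) '' Jid B ψ)

def IsDitkin : Prop := ∀ ψ : characterSpace ℂ B, DitkinAt B ψ

/-- `I` has a bounded approximate identity contained in `J`: a bounded net `(u_i)`
in `J` with `‖b * u_i - b‖ → 0` for every `b ∈ I`. -/
def HasBAI (I J : Set B) : Prop :=
  ∃ (ι : Type) (le : ι → ι → Prop) (u : ι → B) (M : ℝ),
    Nonempty ι ∧ (∀ i j : ι, ∃ k, le i k ∧ le j k) ∧
    (∀ i, u i ∈ J) ∧ (∀ i, ‖u i‖ ≤ M) ∧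
    ∀ b ∈ I, ∀ ε : ℝ, 0 < ε → ∃ i, ∀ j, le i j → ‖b * u j - b‖ < ε

/-- Strong Ditkin's condition at `ψ`. -/
def StrongDitkinAt (ψ : characterSpace ℂ B) : Prop := HasBAI B (Iid B ψ) (Jid B ψ)

def IsStrongDitkin : Prop := ∀ ψ : characterSpace ℂ B, StrongDitkinAt B ψ

/-- Normality. -/
def IsNormal : Prop :=
  ∀ E : Set (characterSpace ℂ B), IsClosed E → E ≠ Set.univ →
    ∀ F : Set (characterSpace ℂ B), IsCompact F → (∀ ψ ∈ F, ψ ∉ E) →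
      ∃ b : B, (∀ ψ ∈ F, ψ b = 1) ∧ ∀ ψ ∈ E, ψ b = 0

/-- Semisimplicity: the Gelfand transform is injective. -/
def IsSemisimple : Prop :=
  ∀ b : B, (∀ ψ : characterSpace ℂ B, ψ b = 0) → b = 0



variable (X : Type*) [TopologicalSpace X] [CompactSpace X] [T2Space X]
variable (A : Type*) [NormedCommRing A] [NormedAlgebra ℂ A] [CompleteSpace A] [Nontrivial A]

section FunctionAlgebra

variable (B : Type*) [NormedCommRing B] [NormedAlgebra ℂ B] [CompleteSpace B] [Nontrivial B]

/-- `𝑨` contains the constant functions. -/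
def ContainsConstants (ι : B →ₐ[ℂ] C(X, A)) : Prop :=
  ∀ a : A, ∃ b : B, ∀ x : X, ι b x = a

/-- `𝑨` separates the points of `X`. -/
def Separates (ι : B →ₐ[ℂ] C(X, A)) : Prop :=
  ∀ x y : X, x ≠ y → ∃ b : B, ι b x ≠ ι b y

/-- Admissibility: `φ ∘ f ∈ 𝑨` whenever `f ∈ 𝑨` and `φ ∈ Φ(A)`. -/
def Admissible (ι : B →ₐ[ℂ] C(X, A)) : Prop :=
  ∀ (f : B) (φ : characterSpace ℂ A), ∃ g : B,
    ∀ x : X, ι g x = algebraMap ℂ A (φ (ι f x))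

/-- The subalgebra `𝔄 = 𝑨 ∩ C(X)` of scalar-valued members of `𝑨`. -/
def scalarSub (ι : B →ₐ[ℂ] C(X, A)) : Subalgebra ℂ B where
  carrier := {b : B | ∀ x : X, ∃ c : ℂ, ι b x = algebraMap ℂ A c}
  mul_mem' := by
    intro b b' hb hb' x
    obtain ⟨c, hc⟩ := hb x
    obtain ⟨c', hc'⟩ := hb' x
    refine ⟨c * c', ?_⟩
    rw [map_mul, ContinuousMap.mul_apply, hc, hc', map_mul]
  add_mem' := by
    intro b b' hb hb' x
    obtain ⟨c, hc⟩ := hb x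
    obtain ⟨c', hc'⟩ := hb' x
    refine ⟨c + c', ?_⟩
    rw [map_add, ContinuousMap.add_apply, hc, hc', map_add]
  algebraMap_mem' := by
    intro r x
    refine ⟨r, ?_⟩
    rw [AlgHom.commutes]
    simp [Algebra.algebraMap_eq_smul_one]

/-- `𝑨` is an `A`-valued uniform algebra: its norm is equivalent to the sup norm. -/
def IsUniform (ι : B →ₐ[ℂ] C(X, A)) : Prop :=
  ∃ c C : ℝ, 0 < c ∧ ∀ b : B, c * ‖ι b‖ ≤ ‖b‖ ∧ ‖b‖ ≤ C * ‖ι b‖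

/-- Every character of `𝑨` is of the form `ψ ⋄ φ`. -/
def NaturalProduct (ι : B →ₐ[ℂ] C(X, A)) : Prop :=
  ∀ τ : characterSpace ℂ B,
    ∃ (ψ : characterSpace ℂ (scalarSub X A B ι)) (φ : characterSpace ℂ A),
      ∀ (f : B) (g : scalarSub X A B ι),
        (∀ x : X, ι (g : B) x = algebraMap ℂ A (φ (ι f x))) → τ f = ψ g

end FunctionAlgebra

end VV

namespace VV

section ApproximateIdentity

variable {B : Type*} [NormedCommRing B]

/-- If every single element of `I` can be approximated by multiples with the bounded family
`u : κ → I`, then finitely many elements of `I` can be approximated simultaneously. -/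
theorem exists_forall_finset_norm_mul_sub_lt {I : Ideal B} {κ : Type*} {u : κ → B} {M : ℝ}
    (hu : ∀ i, u i ∈ I) (hM : ∀ i, ‖u i‖ ≤ M)
    (happ : ∀ b ∈ I, ∀ ε : ℝ, 0 < ε → ∃ i, ‖b * u i - b‖ < ε)
    (s : Finset B) (hs : ∀ b ∈ s, b ∈ I) {ε : ℝ} (hε : 0 < ε) :
    ∃ i, ∀ b ∈ s, ‖b * u i - b‖ < ε := by
  classical
  obtain ⟨i₀, -⟩ := happ 0 I.zero_mem 1 one_pos
  have hM0 : 0 ≤ M := (norm_nonneg _).trans (hM i₀)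
  have h1 (i : κ) : ‖1 - u i‖ ≤ ‖(1 : B)‖ + M :=
    (norm_sub_le _ _).trans (by gcongr; exact hM i)
  have hN : 0 < ‖(1 : B)‖ + M + 1 := by positivity
  have key : ∀ s : Finset B, (∀ b ∈ s, b ∈ I) → ∀ δ : ℝ, 0 < δ →
      ∃ w ∈ I, ∀ b ∈ s, ‖b * w - b‖ < δ := by
    intro s
    induction s using Finset.induction_on with
    | empty => exact fun _ δ _ => ⟨0, I.zero_mem, by simp⟩
    | insert c s _ ih =>
      intro hs δ hδ
      obtain ⟨w, hw, hws⟩ := ih (fun b hb => hs b (Finset.mem_insert_of_mem hb))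
        (δ / (‖(1 : B)‖ + M + 1)) (by positivity)
      have hc : c * w - c ∈ I :=
        I.sub_mem (I.mul_mem_left _ hw) (hs c (Finset.mem_insert_self _ _))
      obtain ⟨i, hi⟩ := happ _ hc δ hδ
      refine ⟨w + u i - w * u i, I.sub_mem (I.add_mem hw (hu i)) (I.mul_mem_left _ (hu i)), ?_⟩
      intro b hb
      rcases Finset.mem_insert.1 hb with rfl | hb
      · have : b * (w + u i - w * u i) - b = -((b * w - b) * u i - (b * w - b)) := by ring
        rwa [this, norm_neg]
      · have : b * (w + u i - w * u i) - b = (b * w - b) * (1 - u i) := by ring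
        rw [this]
        calc ‖(b * w - b) * (1 - u i)‖ ≤ ‖b * w - b‖ * ‖1 - u i‖ := norm_mul_le _ _
          _ ≤ ‖b * w - b‖ * (‖(1 : B)‖ + M + 1) := by gcongr; linarith [h1 i]
          _ < δ := (lt_div_iff₀ hN).1 (hws b hb)
  obtain ⟨w, hw, hws⟩ := key s hs (ε / 2 / (‖(1 : B)‖ + M + 1)) (by positivity)
  set T : ℝ := ∑ b ∈ s, ‖b‖ + 1
  have hT : 0 < T := by positivity
  obtain ⟨i, hi⟩ := happ w hw (ε / 2 / T) (by positivity)
  refine ⟨i, fun b hb => ?_⟩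
  have hbT : ‖b‖ ≤ T := by
    have := Finset.single_le_sum (f := fun b : B => ‖b‖) (fun _ _ => norm_nonneg _) hb
    simp only [T]
    linarith
  have : b * u i - b = (b * w - b) * (1 - u i) + b * (w * u i - w) := by ring
  rw [this]
  calc ‖(b * w - b) * (1 - u i) + b * (w * u i - w)‖
      ≤ ‖b * w - b‖ * ‖1 - u i‖ + ‖b‖ * ‖w * u i - w‖ :=
        (norm_add_le _ _).trans (add_le_add (norm_mul_le _ _) (norm_mul_le _ _))
    _ ≤ ‖b * w - b‖ * (‖(1 : B)‖ + M + 1) + T * ‖w * u i - w‖ := by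
        gcongr
        linarith [h1 i]
    _ < ε / 2 + ε / 2 :=
        add_lt_add ((lt_div_iff₀ hN).1 (hws b hb)) ((lt_div_iff₀' hT).1 hi)
    _ = ε := add_halves ε

/-- A bounded approximate identity of an ideal, expressed with a filter. -/
theorem HasBAI.exists_filter {I : Ideal B} {J : Set B} (hJI : J ⊆ I) (h : HasBAI B I J) :
    ∃ (κ : Type) (l : Filter κ) (u : κ → B) (M : ℝ), l.NeBot ∧ (∀ i, u i ∈ J) ∧
      (∀ i, ‖u i‖ ≤ M) ∧ ∀ b ∈ I, Filter.Tendsto (fun i => b * u i) l (𝓝 b) := by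
  classical
  obtain ⟨κ, le, u, M, -, hdir, huJ, hM, happ⟩ := h
  let m : κ → I → B := fun i b => b * u i
  let l : Filter κ := Filter.comap m (𝓝 fun b => b)
  have hl : Filter.Tendsto m l (𝓝 fun b => b) := Filter.tendsto_comap
  refine ⟨κ, l, u, M, ?_, huJ, hM, fun b hb => tendsto_pi_nhds.1 hl ⟨b, hb⟩⟩
  rw [Filter.comap_neBot_iff]
  intro t ht
  rw [nhds_pi, (Filter.hasBasis_pi fun b : I => Metric.nhds_basis_ball (x := (b : B))).mem_iff]
    at ht
  obtain ⟨⟨S, r⟩, ⟨hS, hr⟩, hSt⟩ := ht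
  obtain ⟨ε, hε, hεr⟩ : ∃ ε : ℝ, 0 < ε ∧ ∀ b ∈ S, ε ≤ r b := by
    lift S to Finset I using hS
    rcases S.eq_empty_or_nonempty with rfl | hne
    · exact ⟨1, one_pos, by simp⟩
    · obtain ⟨b, hb, hmin⟩ := S.exists_min_image r hne
      exact ⟨r b, hr b hb, fun c hc => hmin c hc⟩
  obtain ⟨i, hi⟩ := exists_forall_finset_norm_mul_sub_lt (I := I) (fun i => hJI (huJ i)) hM
    (fun b hb ε hε => by
      obtain ⟨i, hi⟩ := happ b hb ε hε
      obtain ⟨j, hj, -⟩ := hdir i i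
      exact ⟨j, hi j hj⟩)
    (hS.toFinset.image Subtype.val)
    (fun b hb => by
      obtain ⟨c, -, rfl⟩ := Finset.mem_image.1 hb
      exact c.2)
    hε
  refine ⟨i, hSt fun b hb => ?_⟩
  rw [mem_ball_iff_norm]
  exact (hi b (Finset.mem_image_of_mem _ (hS.mem_toFinset.2 hb))).trans_le (hεr b hb)

theorem HasBAI.of_filter {I J : Set B} {κ : Type} {l : Filter κ} [l.NeBot] {u : κ → B} {M : ℝ}
    (hu : ∀ i, u i ∈ J) (hM : ∀ i, ‖u i‖ ≤ M)
    (happ : ∀ b ∈ I, Filter.Tendsto (fun i => b * u i) l (𝓝 b)) : HasBAI B I J := by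
  refine ⟨{p : κ × Set κ // p.2 ∈ l ∧ p.1 ∈ p.2}, fun p q => q.1.2 ⊆ p.1.2, fun p => u p.1.1, M,
    ?_, ?_, fun p => hu _, fun p => hM _, ?_⟩
  · obtain ⟨i⟩ := l.nonempty_of_neBot
    exact ⟨⟨(i, Set.univ), Filter.univ_mem, trivial⟩⟩
  · intro p q
    have h := Filter.inter_mem p.2.1 q.2.1
    obtain ⟨i, hi⟩ := Filter.nonempty_of_mem h
    exact ⟨⟨(i, p.1.2 ∩ q.1.2), h, hi⟩, Set.inter_subset_left, Set.inter_subset_right⟩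
  · intro b hb ε hε
    have h : ∀ᶠ i in l, ‖b * u i - b‖ < ε := by
      simpa only [dist_eq_norm] using Metric.tendsto_nhds.1 (happ b hb) ε hε
    obtain ⟨i, hi⟩ := h.exists
    exact ⟨⟨(i, {i | ‖b * u i - b‖ < ε}), h, hi⟩, fun q hq => hq q.2.2⟩

variable [NormedAlgebra ℂ B]

/-- The kernel of a character, as an ideal. -/
noncomputable def kerIdeal (ψ : characterSpace ℂ B) : Ideal B := RingHom.ker ψ

theorem Jid_subset_Iid (ψ : characterSpace ℂ B) : Jid B ψ ⊆ Iid B ψ := by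
  rintro b ⟨U, hU, h⟩
  exact h ψ (mem_of_mem_nhds hU)

theorem StrongDitkinAt.exists_filter {ψ : characterSpace ℂ B} (h : StrongDitkinAt B ψ) :
    ∃ (κ : Type) (l : Filter κ) (u : κ → B) (M : ℝ), l.NeBot ∧ (∀ i, u i ∈ Jid B ψ) ∧
      (∀ i, ‖u i‖ ≤ M) ∧ ∀ b, ψ b = 0 → Filter.Tendsto (fun i => b * u i) l (𝓝 b) :=
  HasBAI.exists_filter (I := kerIdeal ψ) (Jid_subset_Iid ψ) h

end ApproximateIdentity

section Restriction

variable {A B : Type*} [NormedCommRing A] [NormedAlgebra ℂ A] [NormedCommRing B]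
  [NormedAlgebra ℂ B]

/-- Pullback of a character along a continuous unital homomorphism. -/
noncomputable def pullback (k : A →ₐ[ℂ] B) (hk : Continuous k) (τ : characterSpace ℂ B) :
    characterSpace ℂ A :=
  ⟨StrongDual.toWeakDual ((WeakDual.toStrongDual (τ : WeakDual ℂ B)).comp ⟨k.toLinearMap, hk⟩), by
    rw [CharacterSpace.eq_set_map_one_map_mul]
    exact ⟨(congrArg τ (map_one k)).trans (map_one τ),
      fun a b => (congrArg τ (map_mul k a b)).trans (map_mul τ _ _)⟩⟩

@[simp]
theorem pullback_apply (k : A →ₐ[ℂ] B) (hk : Continuous k) (τ : characterSpace ℂ B) (a : A) :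
    pullback k hk τ a = τ (k a) := rfl

theorem continuous_pullback (k : A →ₐ[ℂ] B) (hk : Continuous k) : Continuous (pullback k hk) :=
  Continuous.subtype_mk (WeakDual.continuous_of_continuous_eval fun a =>
    (WeakDual.eval_continuous (k a)).comp continuous_subtype_val) _

theorem map_mem_Jid {k : A →ₐ[ℂ] B} {hk : Continuous k} {τ : characterSpace ℂ B} {a : A}
    (ha : a ∈ Jid A (pullback k hk τ)) : k a ∈ Jid B τ := by
  obtain ⟨U, hU, h⟩ := ha
  exact ⟨_, (continuous_pullback k hk).continuousAt.preimage_mem_nhds hU, fun χ hχ => h _ hχ⟩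

theorem add_sub_mul_mem_Jid {τ : characterSpace ℂ B} {a b : B} (ha : a ∈ Jid B τ)
    (hb : b ∈ Jid B τ) : a + b - a * b ∈ Jid B τ := by
  obtain ⟨U, hU, hUa⟩ := ha
  obtain ⟨V, hV, hVb⟩ := hb
  refine ⟨U ∩ V, Filter.inter_mem hU hV, fun χ hχ => ?_⟩
  rw [map_sub, map_add, map_mul, hUa χ hχ.1, hVb χ hχ.2]
  simp

end Restriction

section VectorValued

variable {X : Type*} [TopologicalSpace X] {A : Type*} [NormedCommRing A]

/-- On a compact space, pointwise convergence `h x * e i → h x` with `e` bounded is uniform. -/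
theorem tendsto_mul_const_of_bounded [CompactSpace X] {κ : Type*} {l : Filter κ} {e : κ → A} {M : ℝ}
    (hM : ∀ i, ‖e i‖ ≤ M) (h : C(X, A))
    (hlim : ∀ x, Filter.Tendsto (fun i => h x * e i) l (𝓝 (h x))) :
    Filter.Tendsto (fun i => h * ContinuousMap.const X (e i)) l (𝓝 h) := by
  rw [Metric.tendsto_nhds]
  intro ε hε
  set N : ℝ := |M| + 1
  have hN : 0 < N := by positivity
  have hδ : 0 < ε / 4 / N := by positivity
  obtain ⟨t, -, ht⟩ := isCompact_univ.elim_nhds_subcover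
    (fun x => {y | dist (h y) (h x) < ε / 4 / N}) fun x _ =>
      Metric.tendsto_nhds.1 h.continuous.continuousAt _ hδ
  have hev : ∀ᶠ i in l, ∀ x ∈ t, ‖h x * e i - h x‖ < ε / 4 := by
    rw [Filter.eventually_all_finset]
    intro x _
    simpa only [dist_eq_norm] using Metric.tendsto_nhds.1 (hlim x) (ε / 4) (by positivity)
  filter_upwards [hev] with i hi
  rw [dist_eq_norm]
  refine lt_of_le_of_lt ((ContinuousMap.norm_le _ (by positivity : 0 ≤ 3 * (ε / 4))).2 ?_)
    (by linarith : 3 * (ε / 4) < ε)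
  intro y
  obtain ⟨x, hx, hxy⟩ := Set.mem_iUnion₂.1 (ht (Set.mem_univ y))
  have hxy : ‖h y - h x‖ < ε / 4 / N := (dist_eq_norm _ _).symm.trans_lt hxy
  have hy1 : ‖h y - h x‖ * N < ε / 4 := (lt_div_iff₀ hN).1 hxy
  have hy2 : ‖h y - h x‖ ≤ ‖h y - h x‖ * N :=
    le_mul_of_one_le_right (norm_nonneg _) (by simp [N])
  have hy3 : ‖(h y - h x) * e i‖ ≤ ‖h y - h x‖ * N :=
    (norm_mul_le _ _).trans (by
      gcongr
      have := le_abs_self M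
      linarith [hM i])
  have hsplit : (h * ContinuousMap.const X (e i) - h) y
      = (h y - h x) * e i + (h x * e i - h x) - (h y - h x) := by
    simp only [ContinuousMap.sub_apply, ContinuousMap.mul_apply, ContinuousMap.const_apply]
    ring
  rw [hsplit]
  calc _ ≤ ‖(h y - h x) * e i‖ + ‖h x * e i - h x‖ + ‖h y - h x‖ :=
        (norm_sub_le _ _).trans (by gcongr; exact norm_add_le _ _)
    _ ≤ 3 * (ε / 4) := by linarith [hi x hx]

variable [NormedAlgebra ℂ A] {B : Type*} [NormedCommRing B] [NormedAlgebra ℂ B]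

/-- The embedding of `A` as the algebra of constant functions. -/
theorem exists_constHom {ι : B →ₐ[ℂ] C(X, A)} (hinj : Function.Injective ι)
    (hconst : ∀ a : A, ∃ b : B, ∀ x : X, ι b x = a) :
    ∃ k : A →ₐ[ℂ] B, ∀ a, ι (k a) = ContinuousMap.const X a := by
  choose k hk using hconst
  have hk' (a : A) : ι (k a) = ContinuousMap.const X a := ContinuousMap.ext (hk a)
  refine ⟨{ toFun := k, map_one' := ?_, map_mul' := ?_, map_zero' := ?_, map_add' := ?_,
            commutes' := ?_ }, hk'⟩
  · exact hinj (by rw [hk', map_one]; rfl)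
  · exact fun a b => hinj (by rw [map_mul, hk', hk', hk']; rfl)
  · exact hinj (by rw [hk', map_zero]; rfl)
  · exact fun a b => hinj (by rw [map_add, hk', hk', hk']; rfl)
  · exact fun r => hinj (by rw [hk', ι.commutes]; rfl)

end VectorValued

end VV

theorem strongDitkin_of_uniform_components
    (X : Type*) [TopologicalSpace X] [CompactSpace X] [T2Space X]
    (A : Type*) [NormedCommRing A] [NormedAlgebra ℂ A] [CompleteSpace A] [Nontrivial A]
    (hss : VV.IsSemisimple A)
    (B : Type*) [NormedCommRing B] [NormedAlgebra ℂ B] [CompleteSpace B] [Nontrivial B]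
    (ι : B →ₐ[ℂ] C(X, A)) (hinj : Function.Injective ι)
    (hconst : VV.ContainsConstants X A B ι) (hsep : VV.Separates X A B ι)
    (hadm : VV.Admissible X A B ι) (hnat : VV.NaturalProduct X A B ι)
    (hunif : VV.IsUniform X A B ι)
    (hfA : VV.IsStrongDitkin (VV.scalarSub X A B ι)) (hA : VV.IsStrongDitkin A) :
    VV.IsStrongDitkin B := by
  obtain ⟨c, C, hc, hC⟩ := hunif
  obtain ⟨k, hk⟩ := VV.exists_constHom hinj hconst
  have hkC (a : A) : ‖k a‖ ≤ |C| * ‖a‖ := by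
    have h1 : ‖ι (k a)‖ ≤ ‖a‖ := by
      rw [hk, ContinuousMap.norm_le _ (norm_nonneg a)]
      exact fun _ => le_rfl
    calc ‖k a‖ ≤ C * ‖ι (k a)‖ := (hC _).2
      _ ≤ |C| * ‖a‖ := by gcongr; exact le_abs_self C
  have hkcont : Continuous k := AddMonoidHomClass.continuous_of_bound k |C| hkC
  have hvcont : Continuous (VV.scalarSub X A B ι).val := continuous_subtype_val
  intro τ
  have hnat' : ∀ (f : B) (g : VV.scalarSub X A B ι),
      (∀ x, ι (g : B) x = algebraMap ℂ A (VV.pullback k hkcont τ (ι f x))) → τ f = τ g := by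
    obtain ⟨ψ, φ, h⟩ := hnat τ
    have hφ (a : A) : VV.pullback k hkcont τ a = φ a := by
      rw [VV.pullback_apply, h (k a) (algebraMap ℂ _ (φ a)), AlgHomClass.commutes]
      · rfl
      · intro x
        rw [hk, Subalgebra.coe_algebraMap, ι.commutes]
        rfl
    have hψ (g : VV.scalarSub X A B ι) : τ (g : B) = ψ g := by
      refine h g g fun x => ?_
      obtain ⟨z, hz⟩ := g.2 x
      rw [hz, AlgHomClass.commutes]
      rfl
    intro f g hfg
    simp only [hφ] at hfg
    rw [h f g hfg, hψ]
  obtain ⟨κ₁, l₁, e, M₁, hl₁, heJ, heM, he⟩ := (hA (VV.pullback k hkcont τ)).exists_filter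
  obtain ⟨κ₂, l₂, u, M₂, hl₂, huJ, huM, hu⟩ :=
    (hfA (VV.pullback (VV.scalarSub X A B ι).val hvcont τ)).exists_filter
  have hkM (i : κ₁) : ‖k (e i)‖ ≤ |C| * M₁ := (hkC _).trans (by gcongr; exact heM i)
  have huM' (j : κ₂) : ‖(u j : B)‖ ≤ M₂ := huM j
  refine VV.HasBAI.of_filter (l := l₁ ×ˢ l₂)
    (u := fun p => k (e p.1) + (u p.2 : B) - k (e p.1) * u p.2)
    (M := |C| * M₁ + M₂ + |C| * M₁ * M₂)
    (fun p => VV.add_sub_mul_mem_Jid (VV.map_mem_Jid (heJ p.1)) (VV.map_mem_Jid (huJ p.2))) ?_ ?_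
  · intro p
    have hpos : 0 ≤ |C| * M₁ := (norm_nonneg _).trans (hkM p.1)
    refine (norm_sub_le _ _).trans (add_le_add ((norm_add_le _ _).trans
      (add_le_add (hkM _) (huM' _))) ((norm_mul_le _ _).trans ?_))
    exact mul_le_mul (hkM _) (huM' _) (norm_nonneg _) hpos
  · intro f hf
    obtain ⟨g₀, hg₀⟩ := hadm f (VV.pullback k hkcont τ)
    let g : VV.scalarSub X A B ι := ⟨g₀, fun x => ⟨_, hg₀ x⟩⟩
    have hug : Filter.Tendsto (fun j => (g : B) * u j - g) l₂ (𝓝 0) := by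
      have h := hu g ((hnat' f g hg₀).symm.trans hf)
      have h' := (hvcont.tendsto g).comp h
      simpa using h'.sub_const (g : B)
    have heh : Filter.Tendsto (fun i => (f - g) * k (e i) - (f - g)) l₁ (𝓝 0) := by
      have h := VV.tendsto_mul_const_of_bounded heM (ι (f - g)) (fun x => he _ (by
        rw [map_sub, ContinuousMap.sub_apply, map_sub]
        change _ - VV.pullback k hkcont τ (ι g₀ x) = 0
        rw [hg₀, AlgHomClass.commutes]
        exact sub_self _))
      have h0 := (tendsto_iff_norm_sub_tendsto_zero.1 h).const_mul C
      rw [mul_zero] at h0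
      refine squeeze_zero_norm (fun i => ?_) h0
      refine (hC _).2.trans_eq ?_
      rw [map_sub ι, map_mul ι, hk]
    have h1 : Filter.Tendsto (fun p : κ₁ × κ₂ => ((f - g) * k (e p.1) - (f - g)) * (1 - (u p.2 : B)))
        (l₁ ×ˢ l₂) (𝓝 0) := by
      refine squeeze_zero_norm (a := fun p =>
        ‖(f - g) * k (e p.1) - (f - g)‖ * (‖(1 : B)‖ + M₂)) (fun p => ?_) ?_
      · refine (norm_mul_le _ _).trans ?_
        gcongr
        exact (norm_sub_le _ _).trans (by gcongr; exact huM' _)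
      · simpa using ((heh.comp Filter.tendsto_fst).norm).mul_const (‖(1 : B)‖ + M₂)
    have h2 : Filter.Tendsto (fun p : κ₁ × κ₂ => ((g : B) * u p.2 - g) * (1 - k (e p.1)))
        (l₁ ×ˢ l₂) (𝓝 0) := by
      refine squeeze_zero_norm (a := fun p =>
        ‖(g : B) * u p.2 - g‖ * (‖(1 : B)‖ + |C| * M₁)) (fun p => ?_) ?_
      · refine (norm_mul_le _ _).trans ?_
        gcongr
        exact (norm_sub_le _ _).trans (by gcongr; exact hkM _)
      · simpa using ((hug.comp Filter.tendsto_snd).norm).mul_const (‖(1 : B)‖ + |C| * M₁)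
    have h3 := (h1.add h2).const_add f
    rw [add_zero, add_zero] at h3
    refine h3.congr fun p => ?_
    ring
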